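/- Let C be an [n,k]_q maximum weight spectrum code satisfying property (B). Then there exists a nonzero r = (r_1, …, r_{q−1}) ∈ N^{q−1} such that the generalized r-repetition code C(r) is an [Rn, k]_q maximum weight spectrum code satisfying both property (A) and property (B), where R = r_1 + … + r_{q−1}. -/

import Mathlib

/-- The Hamming weight of a vector: the number of nonzero coordinates. -/
def wt {ι F : Type*} [Fintype ι] [Zero F] [DecidableEq F] (c : ι → F) : ℕ :=
  (Finset.univ.filter fun i => c i ≠ 0).card

/-- The weight set of a code: the set of nonzero weights of nonzero codewords. -/
def wtSet {ι F : Type*} [Fintype ι] [Zero F] [DecidableEq F] (C : Set (ι → F)) : Set ℕ :=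
  {w | ∃ c ∈ C, c ≠ 0 ∧ wt c = w}

/-- `cnt c β` is the number of coordinates of `c` equal to `β` (denoted `c[β]`). -/
def cnt {ι F : Type*} [Fintype ι] [DecidableEq F] (c : ι → F) (β : F) : ℕ :=
  (Finset.univ.filter fun i => c i = β).card

/-- The generalized `r`-repetition vector `c^r ∈ F^(Rn)`, `R = ∑ j, r j`: the
concatenation, for `j = 1, …, q-1`, of `r_j` copies of `α^j • c`.  A position `x` lies in
block `b = x / n` (each block has length `n`); the scalar multiplying block `b` is
`α^(j+1)` for the largest index `j : Fin (q-1)` with `∑_{j' < j} r j' ≤ b`, and this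
`j + 1` equals the number of indices `j` with `∑_{j' < j} r j' ≤ b`. -/
def crep {F : Type*} [Field F] {q n : ℕ} (α : F) (r : Fin (q - 1) → ℕ) (c : Fin n → F) :
    Fin ((∑ j, r j) * n) → F := fun x =>
  α ^ (Finset.univ.filter fun j : Fin (q - 1) =>
        (∑ j' ∈ Finset.univ.filter fun j' => j' < j, r j') ≤ x.val / n).card *
    c ⟨x.val % n,
      Nat.mod_lt _ (Nat.pos_of_ne_zero fun h => Nat.not_lt_zero x.val (by simpa [h] using x.2))⟩

/-- `c ↦ c^r` as a linear map. -/
def crepMap {F : Type*} [Field F] (q n : ℕ) (α : F) (r : Fin (q - 1) → ℕ) :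
    (Fin n → F) →ₗ[F] (Fin ((∑ j, r j) * n) → F) where
  toFun c := crep α r c
  map_add' a b := by funext x; simp [crep, mul_add]
  map_smul' s a := by funext x; simp [crep, smul_eq_mul]; ring

/-- Property (A): there is a nonzero `β` such that the count `c[β]` separates codewords. -/
def propA {ι F : Type*} [Fintype ι] [Field F] [DecidableEq F]
    (C : Submodule F (ι → F)) : Prop :=
  ∃ β : F, β ≠ 0 ∧ ∀ a ∈ C, ∀ b ∈ C, cnt a β = cnt b β → a = b

/-- Property (B): for every nonzero codeword `c`, the entries of the distribution vector
`V(c) = (c[α], …, c[α^(q-1)], c[0])` are pairwise distinct; since a primitive element `α`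
enumerates all nonzero field elements, this says `β ↦ c[β]` is injective on `F`. -/
def propB {ι F : Type*} [Fintype ι] [Field F] [DecidableEq F]
    (C : Submodule F (ι → F)) : Prop :=
  ∀ c ∈ C, c ≠ 0 → Function.Injective fun β : F => cnt c β

theorem cnt_eq_sum {ι F : Type*} [Fintype ι] [DecidableEq F] (c : ι → F) (β : F) :
    cnt c β = ∑ i, if c i = β then 1 else 0 := by
  simp [cnt]

theorem cnt_le_card {ι F : Type*} [Fintype ι] [DecidableEq F] (c : ι → F) (β : F) :
    cnt c β ≤ Fintype.card ι :=
  Finset.card_le_univ _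

theorem cnt_zero_add_wt {ι F : Type*} [Fintype ι] [Zero F] [DecidableEq F] (c : ι → F) :
    cnt c 0 + wt c = Fintype.card ι := by
  simpa [cnt, wt] using
    Finset.card_filter_add_card_filter_not (s := (Finset.univ : Finset ι)) (fun i => c i = 0)

theorem cnt_smul {ι F : Type*} [Fintype ι] [Field F] [DecidableEq F] {u : F} (hu : u ≠ 0)
    (c : ι → F) (β : F) : cnt (u • c) (u * β) = cnt c β := by
  simp [cnt, hu]

theorem wt_smul {ι F : Type*} [Fintype ι] [Field F] [DecidableEq F] {u : F} (hu : u ≠ 0)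
    (c : ι → F) : wt (u • c) = wt c := by
  simp [wt, hu]

theorem wt_eq_sum_cnt {ι F : Type*} [Fintype ι] [Zero F] [Fintype F] [DecidableEq F]
    (c : ι → F) : wt c = ∑ β ∈ Finset.univ.filter (· ≠ 0), cnt c β := by
  unfold wt cnt
  rw [Finset.card_eq_sum_card_fiberwise (f := c) (t := Finset.univ.filter (· ≠ 0))
    (by intro i hi; simpa using hi)]
  refine Finset.sum_congr rfl fun β hβ => ?_
  congr 1
  ext i
  simp only [Finset.mem_filter, Finset.mem_univ, true_and] at hβ ⊢
  exact ⟨fun h => h.2, fun h => ⟨h ▸ hβ, h⟩⟩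

theorem card_filter_partialSum_le {m : ℕ} (r : Fin m → ℕ) (j : Fin m) (i : Fin (r j)) :
    (Finset.univ.filter fun j₀ : Fin m =>
      (∑ j' ∈ Finset.univ.filter fun j' => j' < j₀, r j') ≤
        (finSigmaFinEquiv ⟨j, i⟩ : Fin (∑ j, r j)).val).card = j + 1 := by
  have hval : (finSigmaFinEquiv ⟨j, i⟩ : Fin (∑ j, r j)).val =
      ∑ j' ∈ Finset.univ.filter (fun j' => j' < j), r j' + i := by
    rw [finSigmaFinEquiv_apply]
    congr 1
    refine Finset.sum_bij (fun x _ => Fin.castLE j.2.le x) ?_ ?_ ?_ ?_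
    · intro a _
      exact Finset.mem_filter.2 ⟨Finset.mem_univ _, a.2⟩
    · intro a _ b _ h; simpa using h
    · intro b hb
      exact ⟨⟨b, (Finset.mem_filter.1 hb).2⟩, Finset.mem_univ _, rfl⟩
    · intro a _; rfl
  rw [hval, ← Fin.card_Iic]
  congr 1
  ext j₀
  simp only [Finset.mem_filter, Finset.mem_univ, true_and, Finset.mem_Iic]
  constructor
  · intro h
    by_contra! hlt
    have : ∑ j' ∈ Finset.univ.filter (fun j' => j' ≤ j), r j' ≤
        ∑ j' ∈ Finset.univ.filter (fun j' => j' < j₀), r j' :=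
      Finset.sum_le_sum_of_subset fun x hx => by
        simp only [Finset.mem_filter, Finset.mem_univ, true_and] at hx ⊢
        exact hx.trans_lt hlt
    have hsplit : Finset.univ.filter (fun j' => j' ≤ j) =
        insert j (Finset.univ.filter (fun j' => j' < j)) := by
      ext x; simp [le_iff_eq_or_lt]
    rw [hsplit, Finset.sum_insert (by simp)] at this
    have := i.2
    omega
  · intro h
    refine le_trans (Finset.sum_le_sum_of_subset fun x hx => ?_) (Nat.le_add_right _ _)
    simp only [Finset.mem_filter, Finset.mem_univ, true_and] at hx ⊢
    exact hx.trans_le h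

theorem cnt_crep {F : Type*} [Field F] [DecidableEq F] {q n : ℕ} {α : F} (hα : α ≠ 0)
    (r : Fin (q - 1) → ℕ) (c : Fin n → F) (β : F) :
    cnt (crep α r c) β = ∑ j : Fin (q - 1), r j * cnt c ((α ^ (j.val + 1))⁻¹ * β) := by
  rw [cnt_eq_sum, ← finProdFinEquiv.sum_comp, Fintype.sum_prod_type,
    ← finSigmaFinEquiv.sum_comp, Fintype.sum_sigma]
  refine Finset.sum_congr rfl fun j _ => ?_
  refine (Finset.sum_eq_card_nsmul (b := cnt c ((α ^ (j.val + 1))⁻¹ * β)) fun i _ => ?_).trans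
    (by rw [Finset.card_univ, Fintype.card_fin, smul_eq_mul])
  rw [cnt_eq_sum]
  refine Finset.sum_congr rfl fun y _ => ?_
  have hn : 0 < n := y.pos
  have hdiv : (finProdFinEquiv (finSigmaFinEquiv ⟨j, i⟩, y) :
      Fin ((∑ j, r j) * n)).val / n = (finSigmaFinEquiv ⟨j, i⟩ : Fin (∑ j, r j)).val := by
    simp [finProdFinEquiv, Nat.add_mul_div_left _ _ hn, Nat.div_eq_of_lt y.2]
  have hmod : (finProdFinEquiv (finSigmaFinEquiv ⟨j, i⟩, y) :
      Fin ((∑ j, r j) * n)).val % n = y.val := by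
    simp [finProdFinEquiv, Nat.mod_eq_of_lt y.2]
  simp only [crep, hdiv, hmod, card_filter_partialSum_le, Fin.eta]
  exact if_congr (eq_inv_mul_iff_mul_eq₀ (pow_ne_zero _ hα)).symm rfl rfl

theorem wt_crep {F : Type*} [Field F] [DecidableEq F] {q n : ℕ} {α : F} (hα : α ≠ 0)
    (r : Fin (q - 1) → ℕ) (c : Fin n → F) : wt (crep α r c) = (∑ j, r j) * wt c := by
  have h₁ := cnt_zero_add_wt (crep α r c)
  have h₂ := cnt_zero_add_wt c
  rw [cnt_crep hα] at h₁
  simp only [mul_zero, ← Finset.sum_mul, Fintype.card_fin] at h₁ h₂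
  exact Nat.add_left_cancel (h₁.trans (by rw [← mul_add, h₂]))

theorem wt_eq_zero_iff {ι F : Type*} [Fintype ι] [Zero F] [DecidableEq F] {c : ι → F} :
    wt c = 0 ↔ c = 0 := by
  simp [wt, Finset.filter_eq_empty_iff, funext_iff]

/-- In a maximum weight spectrum code, the weight determines a nonzero codeword up to a
scalar. -/
theorem exists_smul_eq_of_wt_eq {ι F : Type*} [Fintype ι] [Field F] [Fintype F] [DecidableEq F]
    {C : Submodule F (ι → F)}
    (hC : (wtSet (C : Set (ι → F))).ncard =
      (Fintype.card F ^ Module.finrank F C - 1) / (Fintype.card F - 1))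
    {a b : ι → F} (ha : a ∈ C) (hb : b ∈ C) (ha₀ : a ≠ 0) (hb₀ : b ≠ 0) (h : wt a = wt b) :
    ∃ u : F, u ≠ 0 ∧ u • b = a := by
  classical
  let f : Projectivization F C → wtSet (C : Set (ι → F)) :=
    Projectivization.lift (fun v => ⟨wt v.1.1, v.1.1, v.1.2, by simpa using v.2, rfl⟩) <| by
      rintro ⟨x, hx⟩ ⟨y, hy⟩ t rfl
      have ht : t ≠ 0 := by rintro rfl; simp at hx
      simp [wt_smul ht]
  have hsurj : Function.Surjective f := by
    rintro ⟨w, c, hc, hc₀, rfl⟩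
    exact ⟨Projectivization.mk F ⟨c, hc⟩ (by simpa using hc₀), rfl⟩
  have hcard : Nat.card (Projectivization F C) = Nat.card (wtSet (C : Set (ι → F))) := by
    rw [Projectivization.card'', Nat.card_coe_set_eq, hC, Module.natCard_eq_pow_finrank (K := F),
      Nat.card_eq_fintype_card]
  have hinj : Function.Injective f := (hsurj.bijective_of_nat_card_le hcard.le).1
  have hmk : Projectivization.mk F (⟨a, ha⟩ : C) (by simpa using ha₀) =
      Projectivization.mk F ⟨b, hb⟩ (by simpa using hb₀) :=
    hinj (Subtype.ext h)
  obtain ⟨u, hu⟩ := (Projectivization.mk_eq_mk_iff F _ _ _ _).1 hmk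
  exact ⟨u, u.ne_zero, congrArg Subtype.val hu⟩

/-- In a maximum weight spectrum code with property (B), the numbers of occurrences of the
nonzero field elements determine the codeword. -/
theorem eq_of_cnt_eq {ι F : Type*} [Fintype ι] [Field F] [Fintype F] [DecidableEq F]
    {C : Submodule F (ι → F)}
    (hC : (wtSet (C : Set (ι → F))).ncard =
      (Fintype.card F ^ Module.finrank F C - 1) / (Fintype.card F - 1))
    (hB : propB C) {a b : ι → F} (ha : a ∈ C) (hb : b ∈ C)
    (h : ∀ γ : F, γ ≠ 0 → cnt a γ = cnt b γ) : a = b := by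
  have hwt : wt a = wt b := by
    rw [wt_eq_sum_cnt, wt_eq_sum_cnt]
    exact Finset.sum_congr rfl fun γ hγ => h γ (by simpa using hγ)
  by_cases hb₀ : b = 0
  · rw [hb₀, ← wt_eq_zero_iff, hwt, wt_eq_zero_iff, hb₀]
  have ha₀ : a ≠ 0 := by rwa [Ne, ← wt_eq_zero_iff, hwt, wt_eq_zero_iff]
  obtain ⟨u, hu, rfl⟩ := exists_smul_eq_of_wt_eq hC ha hb ha₀ hb₀ hwt
  have hu₁ : (1 : F) = u := hB b hb hb₀ <| by
    have := h (u * 1) (by simpa using hu)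
    rwa [cnt_smul hu, mul_one] at this
  rw [← hu₁, one_smul]

theorem eq_of_sum_pow_mul_eq {m n : ℕ} {v w : Fin m → ℕ} (hv : ∀ j, v j ≤ n)
    (hw : ∀ j, w j ≤ n)
    (h : ∑ j : Fin m, (n + 1) ^ j.val * v j = ∑ j : Fin m, (n + 1) ^ j.val * w j) : v = w := by
  have key : finFunctionFinEquiv (fun j => (⟨v j, Nat.lt_succ_of_le (hv j)⟩ : Fin (n + 1))) =
      finFunctionFinEquiv (fun j => (⟨w j, Nat.lt_succ_of_le (hw j)⟩ : Fin (n + 1))) := by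
    ext
    simpa only [finFunctionFinEquiv_apply, mul_comm] using h
  funext j
  exact congrArg Fin.val (congrFun (finFunctionFinEquiv.injective key) j)

theorem exists_inv_pow_succ_eq {F : Type*} [Field F] [Fintype F] {α : F}
    (hα : orderOf α = Fintype.card F - 1) {γ : F} (hγ : γ ≠ 0) :
    ∃ j : Fin (Fintype.card F - 1), (α ^ (j.val + 1))⁻¹ = γ := by
  classical
  have hpos : 0 < orderOf α := by
    rw [hα]
    exact Nat.sub_pos_of_lt Fintype.one_lt_card
  have hα₀ : α ≠ 0 := by
    rintro rfl
    simp at hpos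
  have hord : orderOf (Units.mk0 α hα₀) = Nat.card Fˣ := by
    rw [← orderOf_units, Units.val_mk0, hα, Nat.card_eq_fintype_card, Fintype.card_units]
  have hmem : (Units.mk0 γ hγ)⁻¹ * (Units.mk0 α hα₀)⁻¹ ∈ Submonoid.powers (Units.mk0 α hα₀) :=
    mem_powers_iff_mem_zpowers.2 <| by
      rw [Subgroup.eq_top_of_card_eq (Subgroup.zpowers (Units.mk0 α hα₀))
        (by rw [Nat.card_zpowers, hord])]
      trivial
  obtain ⟨m, hm, hmα⟩ := Finset.mem_image.1 (mem_powers_iff_mem_range_orderOf.1 hmem)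
  refine ⟨⟨m, ?_⟩, ?_⟩
  · rwa [Finset.mem_range, ← orderOf_units, Units.val_mk0, hα] at hm
  · have := congrArg Units.val hmα
    simp only [Units.val_pow_eq_pow_val, Units.val_mk0, Units.val_mul, Units.val_inv_eq_inv_val]
      at this
    rw [pow_succ, this, inv_mul_cancel_right₀ hα₀, inv_inv]

/-- If `C` is an `[n,k]_q` maximum weight spectrum code satisfying property (B), then
there is a nonzero `r ∈ ℕ^(q-1)` such that the generalized `r`-repetition code `C(r)`
(of length `Rn`, `R = ∑ j, r j`) is an `[Rn,k]_q` maximum weight spectrum code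
satisfying properties (A) and (B). -/
theorem exists_r_repetition_MWS_propA_propB (q n k : ℕ) (hq : IsPrimePow q)
    (F : Type*) [Field F] [Fintype F] [DecidableEq F] (hcard : Fintype.card F = q)
    (α : F) (hα : orderOf α = q - 1)
    (C : Submodule F (Fin n → F)) (hdim : Module.finrank F C = k)
    (hMWS : (wtSet (C : Set (Fin n → F))).ncard = (q ^ k - 1) / (q - 1))
    (hB : propB C) :
    ∃ r : Fin (q - 1) → ℕ, r ≠ 0 ∧
      Module.finrank F (C.map (crepMap q n α r)) = k ∧
      (wtSet ((C.map (crepMap q n α r) : Submodule F (Fin ((∑ j, r j) * n) → F)) :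
          Set (Fin ((∑ j, r j) * n) → F))).ncard = (q ^ k - 1) / (q - 1) ∧
      propA (C.map (crepMap q n α r)) ∧ propB (C.map (crepMap q n α r)) := by
  subst hcard hdim
  have hpos : 0 < Fintype.card F - 1 := Nat.sub_pos_of_lt Fintype.one_lt_card
  have hα₀ : α ≠ 0 := by
    rintro rfl
    simp at hα
    omega
  set r : Fin (Fintype.card F - 1) → ℕ := fun j => (n + 1) ^ j.val with hr
  have hr₀ : r ≠ 0 := fun h => by simpa [hr] using congrFun h ⟨0, hpos⟩
  have hR : 0 < ∑ j, r j := by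
    refine Finset.sum_pos (fun j _ => by positivity) ⟨⟨0, hpos⟩, Finset.mem_univ _⟩
  have hwt (c : Fin n → F) : wt (crepMap _ n α r c) = (∑ j, r j) * wt c := wt_crep hα₀ r c
  have hsep {a b : Fin n → F} {β γ : F}
      (h : cnt (crepMap _ n α r a) β = cnt (crepMap _ n α r b) γ)
      (j : Fin (Fintype.card F - 1)) :
      cnt a ((α ^ (j.val + 1))⁻¹ * β) = cnt b ((α ^ (j.val + 1))⁻¹ * γ) := by
    have h' : cnt (crep α r a) β = cnt (crep α r b) γ := h
    rw [cnt_crep hα₀, cnt_crep hα₀] at h'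
    have hle (c : Fin n → F) (δ : F) : cnt c δ ≤ n := by simpa using cnt_le_card c δ
    exact congrFun (eq_of_sum_pow_mul_eq (fun _ => hle _ _) (fun _ => hle _ _) h') j
  have hinj : Function.Injective (crepMap (Fintype.card F) n α r) := by
    rw [← LinearMap.ker_eq_bot, LinearMap.ker_eq_bot']
    intro c hc
    have := hwt c
    rw [hc, wt_eq_zero_iff.2 rfl] at this
    exact wt_eq_zero_iff.1 ((Nat.mul_eq_zero.1 this.symm).resolve_left hR.ne')
  refine ⟨r, hr₀, (Submodule.equivMapOfInjective _ hinj C).finrank_eq.symm, ?_, ⟨1, one_ne_zero, ?_⟩, ?_⟩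
  · refine (congrArg Set.ncard ?_).trans
      ((Set.ncard_image_of_injective _ (mul_right_injective₀ hR.ne')).trans hMWS)
    ext w
    constructor
    · rintro ⟨_, ⟨c, hc, rfl⟩, hc₀, rfl⟩
      exact ⟨wt c, ⟨c, hc, fun h => hc₀ (by rw [h, map_zero]), rfl⟩, (hwt c).symm⟩
    · rintro ⟨_, ⟨c, hc, hc₀, rfl⟩, rfl⟩
      exact ⟨_, ⟨c, hc, rfl⟩, fun h => hc₀ (hinj (by rw [h, map_zero])), hwt c⟩
  · rintro _ ⟨a, ha, rfl⟩ _ ⟨b, hb, rfl⟩ h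
    refine congrArg _ (eq_of_cnt_eq hMWS hB ha hb fun γ hγ => ?_)
    obtain ⟨j, rfl⟩ := exists_inv_pow_succ_eq hα hγ
    simpa using hsep h j
  · rintro _ ⟨c, hc, rfl⟩ hc₀ β γ h
    have := hB c hc (fun h => hc₀ (by rw [h, map_zero])) (hsep h ⟨0, hpos⟩)
    exact mul_left_cancel₀ (inv_ne_zero (pow_ne_zero _ hα₀)) this
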